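/- For Re(1-a) > 0 and Re(s) > 0, ∫₀^∞ e^{-st} t^{-a} ₁F₁(a; c; st/2) dt = s^{a-1} Γ(1-a) Γ(c/2) Γ((c+1)/2) / (Γ((a+c)/2) Γ((c-a+1)/2)). -/

import Mathlib

open Complex Set MeasureTheory

/-- Pochhammer symbol `(a)_n` on the complex numbers. -/
noncomputable def poch (a : ℂ) (n : ℕ) : ℂ := (ascPochhammer ℂ n).eval a

/-- Generalized hypergeometric series with numerator parameters `as` and
denominator parameters `bs`, evaluated at `z`. -/
noncomputable def hyp (as bs : List ℂ) (z : ℂ) : ℂ :=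
  ∑' n : ℕ, ((as.map fun a => poch a n).prod /
    ((bs.map fun b => poch b n).prod * (n.factorial : ℂ))) * z ^ n

open Filter Topology

@[simp] lemma poch_zero (a : ℂ) : poch a 0 = 1 := by simp [poch]

lemma poch_succ (a : ℂ) (n : ℕ) : poch a (n + 1) = poch a n * (a + n) :=
  ascPochhammer_succ_eval n a

lemma poch_succ_left (a : ℂ) (n : ℕ) : poch a (n + 1) = a * poch (a + 1) n := by
  simp [poch, ascPochhammer_succ_left, Polynomial.eval_comp]

lemma add_natCast_ne_zero {c : ℂ} (hc : ∀ n : ℕ, c ≠ -(n : ℂ)) (n : ℕ) : c + n ≠ 0 :=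
  fun h => hc n (eq_neg_of_add_eq_zero_left h)

lemma poch_ne_zero {c : ℂ} (hc : ∀ n : ℕ, c ≠ -(n : ℂ)) (n : ℕ) : poch c n ≠ 0 := by
  induction n with
  | zero => simp
  | succ n ih => rw [poch_succ]; exact mul_ne_zero ih (add_natCast_ne_zero hc n)

lemma add_one_ne_neg_natCast {c : ℂ} (hc : ∀ n : ℕ, c ≠ -(n : ℂ)) (n : ℕ) :
    c + 1 ≠ -(n : ℂ) := fun h => hc (n + 1) (by push_cast; linear_combination h)

lemma summable_norm_of_tendsto_ratio {f q : ℕ → ℂ} {l : ℝ} (hl : l < 1)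
    (hq : Tendsto (fun n => ‖q n‖) atTop (𝓝 l)) (hf : ∀ n, f (n + 1) = q n * f n) :
    Summable fun n => ‖f n‖ := by
  obtain ⟨r, hlr, hr⟩ := exists_between hl
  refine summable_of_ratio_norm_eventually_le hr ?_
  filter_upwards [hq.eventually_le_const hlr] with n hn
  rw [hf, norm_norm, norm_norm, norm_mul]
  gcongr

/-- The ratio of two translates of `n` tends to one. -/
lemma tendsto_add_natCast_div (a b : ℂ) :
    Tendsto (fun n : ℕ => (a + n) / (b + n)) atTop (𝓝 1) := by
  have h (x : ℂ) : Tendsto (fun n : ℕ => x / (n : ℂ) + 1) atTop (𝓝 1) := by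
    simpa using (tendsto_const_div_atTop_nhds_zero_nat x).add_const 1
  have := (h a).div (h b) one_ne_zero
  rw [div_one] at this
  refine this.congr' ?_
  filter_upwards [eventually_ne_atTop 0] with n hn
  have : (n : ℂ) ≠ 0 := by exact_mod_cast hn
  simp only [Pi.div_apply]
  rw [div_add_one this, div_add_one this, div_div_div_cancel_right₀ this]

lemma tendsto_inv_natCast_add (b : ℂ) : Tendsto (fun n : ℕ => (b + n : ℂ)⁻¹) atTop (𝓝 0) :=
  tendsto_inv₀_cobounded.comp
    ((tendsto_const_add_cobounded b).comp tendsto_natCast_atTop_cobounded)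

/-- Coefficients of the confluent hypergeometric series. -/
noncomputable def kummerCoeff (a c : ℂ) (n : ℕ) : ℂ := poch a n / (poch c n * n.factorial)

lemma hyp_one_one (a c z : ℂ) : hyp [a] [c] z = ∑' n, kummerCoeff a c n * z ^ n := by
  simp [hyp, kummerCoeff]

section

variable {a c : ℂ}

lemma kummerCoeff_succ (hc : ∀ n : ℕ, c ≠ -(n : ℂ)) (n : ℕ) :
    (c + n) * (n + 1) * kummerCoeff a c (n + 1) = (a + n) * kummerCoeff a c n := by
  have h1 := poch_ne_zero hc n
  have h2 := add_natCast_ne_zero hc n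
  have h3 : (n.factorial : ℂ) ≠ 0 := by exact_mod_cast n.factorial_ne_zero
  have h4 : (n + 1 : ℂ) ≠ 0 := by exact_mod_cast n.succ_ne_zero
  simp only [kummerCoeff, poch_succ, Nat.factorial_succ]
  push_cast
  field_simp

lemma kummerCoeff_succ' (hc : ∀ n : ℕ, c ≠ -(n : ℂ)) (n : ℕ) :
    kummerCoeff a c (n + 1) = (a + n) / (c + n) * (1 + n : ℂ)⁻¹ * kummerCoeff a c n := by
  have h2 := add_natCast_ne_zero hc n
  have h4 : (1 + n : ℂ) ≠ 0 := by rw [add_comm]; exact_mod_cast n.succ_ne_zero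
  have := kummerCoeff_succ (a := a) hc n
  field_simp
  linear_combination this

lemma kummerCoeff_deriv (hc : ∀ n : ℕ, c ≠ -(n : ℂ)) (n : ℕ) :
    (n + 1) * kummerCoeff a c (n + 1) = a / c * kummerCoeff (a + 1) (c + 1) n := by
  have h1 := poch_ne_zero (add_one_ne_neg_natCast hc) n
  have h2 : c ≠ 0 := by simpa using hc 0
  have h3 : (n.factorial : ℂ) ≠ 0 := by exact_mod_cast n.factorial_ne_zero
  have h4 : (n + 1 : ℂ) ≠ 0 := by exact_mod_cast n.succ_ne_zero
  simp only [kummerCoeff, poch_succ_left, Nat.factorial_succ]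
  push_cast
  field_simp

lemma summable_norm_kummerCoeff (hc : ∀ n : ℕ, c ≠ -(n : ℂ)) (z : ℂ) :
    Summable fun n => ‖kummerCoeff a c n * z ^ n‖ := by
  refine summable_norm_of_tendsto_ratio (q := fun n : ℕ => (a + n) / (c + n) * (1 + n : ℂ)⁻¹ * z)
    zero_lt_one ?_ fun n => ?_
  · simpa using (((tendsto_add_natCast_div a c).mul (tendsto_inv_natCast_add 1)).mul_const z).norm
  · rw [kummerCoeff_succ' hc]; ring

lemma hasDerivAt_hyp (hc : ∀ n : ℕ, c ≠ -(n : ℂ)) (z : ℂ) :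
    HasDerivAt (hyp [a] [c]) (a / c * hyp [a + 1] [c + 1] z) z := by
  have hc1 := add_one_ne_neg_natCast hc
  have hF : hyp [a] [c] = fun z => ∑' n, kummerCoeff a c n * z ^ n := funext (hyp_one_one a c)
  have key (n : ℕ) (y : ℂ) : kummerCoeff a c (n + 1) * (((n + 1 : ℕ) : ℂ) * y ^ n)
      = a / c * (kummerCoeff (a + 1) (c + 1) n * y ^ n) := by
    push_cast
    linear_combination y ^ n * kummerCoeff_deriv (a := a) hc n
  set R : ℝ := ‖z‖ + 1
  have hR : 0 ≤ R := by positivity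
  have hu : Summable fun n => ‖kummerCoeff a c n * ((n : ℂ) * (R : ℂ) ^ (n - 1))‖ := by
    rw [← summable_nat_add_iff 1]
    simp only [Nat.add_sub_cancel, key, norm_mul (a / c)]
    exact (summable_norm_kummerCoeff hc1 _).mul_left _
  have hz : z ∈ Metric.ball (0 : ℂ) R := by simp [R]
  have := hasDerivAt_tsum_of_isPreconnected (𝕜 := ℂ) (g := fun n z => kummerCoeff a c n * z ^ n)
    (g' := fun n z => kummerCoeff a c n * ((n : ℂ) * z ^ (n - 1))) (t := Metric.ball 0 R)
    hu Metric.isOpen_ball (convex_ball _ _).isPreconnected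
    (fun n y _ => (hasDerivAt_pow n y).const_mul _)
    (fun n y hy => by
      have : ‖y‖ ≤ R := by simpa using (Metric.mem_ball.1 hy).le
      simp only [norm_mul, norm_pow, Complex.norm_real, Real.norm_eq_abs, abs_of_nonneg hR]
      gcongr) hz (summable_norm_kummerCoeff hc z).of_norm hz
  rw [hF]
  have hs : Summable fun n => kummerCoeff a c n * ((n : ℂ) * z ^ (n - 1)) := by
    rw [← summable_nat_add_iff 1]
    simp only [Nat.add_sub_cancel, key]
    exact (summable_norm_kummerCoeff hc1 _).of_norm.mul_left _
  rw [hs.tsum_eq_zero_add] at this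
  simpa only [Nat.add_sub_cancel, key, tsum_mul_left, ← hyp_one_one, Nat.cast_zero, zero_mul,
    mul_zero, zero_add] using this

/-- Kummer's differential equation. -/
lemma kummer_ode (hc : ∀ n : ℕ, c ≠ -(n : ℂ)) (z : ℂ) :
    z * ((a / c) * ((a + 1) / (c + 1) * hyp [a + 2] [c + 2] z)) =
      a * hyp [a] [c] z - (c - z) * (a / c * hyp [a + 1] [c + 1] z) := by
  have hc1 := add_one_ne_neg_natCast hc
  have hc2 := add_one_ne_neg_natCast hc1
  have e (x : ℂ) : x + 1 + 1 = x + 2 := by ring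
  rw [e] at hc2
  have H0 := (summable_norm_kummerCoeff (a := a) hc z).of_norm.hasSum
  have H1 := (summable_norm_kummerCoeff (a := a + 1) hc1 z).of_norm.hasSum
  have H2 := (summable_norm_kummerCoeff (a := a + 2) hc2 z).of_norm.hasSum
  rw [← hyp_one_one] at H0 H1 H2
  have h1 (n : ℕ) := kummerCoeff_deriv (a := a) hc n
  have h2 (n : ℕ) := kummerCoeff_deriv (a := a + 1) hc1 n
  simp only [e] at h2
  have H1' : HasSum (fun n : ℕ => n * (kummerCoeff a c n * z ^ n))
      (z * (a / c * hyp [a + 1] [c + 1] z)) := by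
    refine (hasSum_nat_add_iff' 1).1 ?_
    simp only [Finset.sum_range_one, Nat.cast_zero, zero_mul, sub_zero]
    refine ((H1.mul_left (a / c)).mul_left z).congr_fun ?_
    intro n
    push_cast
    linear_combination z ^ (n + 1) * h1 n
  have H2' : HasSum (fun n : ℕ => n * ((a / c) * (kummerCoeff (a + 1) (c + 1) n * z ^ n)))
      (z * (a / c * ((a + 1) / (c + 1) * hyp [a + 2] [c + 2] z))) := by
    refine (hasSum_nat_add_iff' 1).1 ?_
    simp only [Finset.sum_range_one, Nat.cast_zero, zero_mul, sub_zero]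
    refine (((H2.mul_left ((a + 1) / (c + 1))).mul_left (a / c)).mul_left z).congr_fun ?_
    intro n
    push_cast
    linear_combination z ^ (n + 1) * (a / c) * h2 n
  have := ((H2'.add ((H1.mul_left (a / c)).mul_left c)).sub H1').sub (H0.mul_left a)
  have h0 := this.unique (hasSum_zero.congr_fun fun n => by
    linear_combination z ^ n * kummerCoeff_succ (a := a) hc n - z ^ n * (n + c) * h1 n)
  linear_combination h0

lemma energy_inequality {U V I J α γ κ δ r : ℝ} (hκ : 0 < κ) (hr : 0 < r) (hα : 0 ≤ α)
    (hI : r * I ≤ V * (α * U + γ * V)) (hJ : J ≤ U * V - κ * U ^ 2) (hδ : 0 < δ)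
    (h1 : α ≤ κ * δ * κ * r) (h2 : α + 2 * γ ≤ δ * r) :
    I + κ * δ * J ≤ δ * (V ^ 2 + κ * δ * U ^ 2) := by
  have hI' : 2 * I ≤ κ * δ * κ * U ^ 2 + δ * V ^ 2 := by
    refine le_of_mul_le_mul_left ?_ hr
    nlinarith [mul_nonneg hα (sq_nonneg (U - V)), mul_le_mul_of_nonneg_right h1 (sq_nonneg U),
      mul_le_mul_of_nonneg_right h2 (sq_nonneg V)]
  have hJ' : κ * δ * (2 * J) ≤ δ * V ^ 2 - κ * δ * κ * U ^ 2 := by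
    nlinarith [mul_le_mul_of_nonneg_left hJ (mul_pos hκ hδ).le,
      mul_nonneg hδ.le (sq_nonneg (κ * U - V))]
  have : 0 ≤ δ * (κ * δ * U ^ 2) := by positivity
  linarith

/-- Along a ray in the open right half plane, the energy of a solution of Kummer's equation,
rescaled by `exp (-z)`, grows slower than any given exponential. -/
lemma kummer_energy_antitone {a c : ℂ} {w w₁ w₂ : ℂ → ℂ} (hw : ∀ z, HasDerivAt w (w₁ z) z)
    (hw₁ : ∀ z, HasDerivAt w₁ (w₂ z) z) (hode : ∀ z, z * w₂ z = a * w z - (c - z) * w₁ z)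
    {κ δ R : ℝ} (hκ : 0 < κ) (hδ : 0 < δ) (hR : 0 < R) (h1 : ‖a‖ ≤ κ * δ * κ * R)
    (h2 : ‖a‖ + 2 * ‖c‖ ≤ δ * R) {ω : ℂ} (hω : ‖ω‖ = 1) (hωκ : κ ≤ ω.re) :
    AntitoneOn (fun r : ℝ => Real.exp (-(2 * δ * r)) *
      (‖w₁ (r * ω) * exp (-(r * ω))‖ ^ 2 + κ * δ * ‖w (r * ω) * exp (-(r * ω))‖ ^ 2)) (Ici R) := by
  have hray (r : ℝ) : HasDerivAt (fun x : ℂ => x * ω) ω r := by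
    simpa using (hasDerivAt_id (r : ℂ)).mul_const ω
  have hE (r : ℝ) : HasDerivAt (fun x : ℂ => exp (-(x * ω))) (exp (-(r * ω)) * -ω) r :=
    (hray r).neg.cexp
  have hu (r : ℝ) : HasDerivAt (fun r : ℝ => w (r * ω) * exp (-(r * ω)))
      (ω * (w₁ (r * ω) * exp (-(r * ω)) - w (r * ω) * exp (-(r * ω)))) r := by
    have := (((hw (r * ω)).comp (r : ℂ) (hray r)).mul (hE r)).comp_ofReal
    convert! this using 1
    simp only [Function.comp_apply]; ring
  have hv (r : ℝ) : HasDerivAt (fun r : ℝ => w₁ (r * ω) * exp (-(r * ω)))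
      (ω * (w₂ (r * ω) - w₁ (r * ω)) * exp (-(r * ω))) r := by
    have := (((hw₁ (r * ω)).comp (r : ℂ) (hray r)).mul (hE r)).comp_ofReal
    convert! this using 1
    simp only [Function.comp_apply]; ring
  have hexp (r : ℝ) : HasDerivAt (fun r : ℝ => Real.exp (-(2 * δ * r)))
      (Real.exp (-(2 * δ * r)) * -(2 * δ)) r := by
    simpa using ((hasDerivAt_id r).const_mul (2 * δ)).neg.exp
  have hd (r : ℝ) := (hexp r).mul ((hv r).norm_sq.add ((hu r).norm_sq.const_mul (κ * δ)))
  refine antitoneOn_of_deriv_nonpos (convex_Ici R)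
    (fun r _ => (hd r).continuousAt.continuousWithinAt)
    (fun r _ => (hd r).differentiableAt.differentiableWithinAt) fun r hr => ?_
  rw [interior_Ici, mem_Ioi] at hr
  have hr0 : 0 < r := hR.trans hr
  refine ((hd r).deriv).trans_le ?_
  set u := w (r * ω) * exp (-(r * ω))
  set v := w₁ (r * ω) * exp (-(r * ω)) with hvdef
  set v' := ω * (w₂ (r * ω) - w₁ (r * ω)) * exp (-(r * ω)) with hv'
  have hI : r * inner ℝ v v' ≤ ‖v‖ * (‖a‖ * ‖u‖ + ‖c‖ * ‖v‖) := by
    have e : (r : ℝ) • v' = a * u - c * v := by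
      rw [Complex.real_smul, hv', hvdef]
      linear_combination exp (-(r * ω)) * hode (r * ω)
    rw [← real_inner_smul_right, e]
    refine (real_inner_le_norm _ _).trans ?_
    gcongr
    simpa only [norm_mul] using norm_sub_le (a * u) (c * v)
  have hJ : inner ℝ u (ω * (v - u)) ≤ ‖u‖ * ‖v‖ - κ * ‖u‖ ^ 2 := by
    have e : inner ℝ u (ω * u) = ω.re * ‖u‖ ^ 2 := by
      rw [Complex.inner, ← Complex.normSq_eq_norm_sq, Complex.normSq_apply]
      simp; ring
    rw [mul_sub, inner_sub_right, e]
    refine sub_le_sub ((real_inner_le_norm _ _).trans_eq ?_) (by gcongr)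
    rw [norm_mul ω, hω, one_mul]
  have key := energy_inequality hκ hr0 (norm_nonneg a) hI hJ hδ (h1.trans (by gcongr))
    (h2.trans (by gcongr))
  simp only [Pi.add_apply]
  nlinarith [mul_le_mul_of_nonneg_left key (Real.exp_pos (-(2 * δ * r))).le]

/-- Growth of solutions of Kummer's equation in a sector. -/
lemma exists_kummer_bound {a c : ℂ} {w w₁ w₂ : ℂ → ℂ} (hw : ∀ z, HasDerivAt w (w₁ z) z)
    (hw₁ : ∀ z, HasDerivAt w₁ (w₂ z) z) (hode : ∀ z, z * w₂ z = a * w z - (c - z) * w₁ z)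
    {κ δ : ℝ} (hκ : 0 < κ) (hδ : 0 < δ) :
    ∃ C, ∀ z : ℂ, κ * ‖z‖ ≤ z.re →
      ‖w z‖ ≤ C * Real.exp (z.re + δ * ‖z‖) ∧ ‖w₁ z‖ ≤ C * Real.exp (z.re + δ * ‖z‖) := by
  obtain ⟨R, hR, h1, h2⟩ : ∃ R : ℝ, 0 < R ∧ ‖a‖ ≤ κ * δ * κ * R ∧ ‖a‖ + 2 * ‖c‖ ≤ δ * R := by
    refine ⟨max 1 (max (‖a‖ / (κ * δ * κ)) ((‖a‖ + 2 * ‖c‖) / δ)), by positivity, ?_, ?_⟩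
    · rw [← div_le_iff₀' (by positivity)]; simp
    · rw [← div_le_iff₀' (by positivity)]; simp
  obtain ⟨K₀, hK₀⟩ := (isCompact_closedBall (0 : ℂ) R).exists_bound_of_continuousOn
    (f := w) fun z _ => (hw z).continuousAt.continuousWithinAt
  obtain ⟨K₁, hK₁⟩ := (isCompact_closedBall (0 : ℂ) R).exists_bound_of_continuousOn
    (f := w₁) fun z _ => (hw₁ z).continuousAt.continuousWithinAt
  set K := max K₀ K₁
  have hK : 0 ≤ K := (norm_nonneg _).trans ((hK₀ 0 (by simp [hR.le])).trans (le_max_left _ _))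
  set B := K ^ 2 + κ * δ * K ^ 2
  have hB : 0 ≤ B := by positivity
  refine ⟨K + √B + √(B / (κ * δ)), fun z hz => ?_⟩
  have hre : 0 ≤ z.re := (by positivity : 0 ≤ κ * ‖z‖).trans hz
  rcases le_total ‖z‖ R with hzR | hRz
  · have h1e : 1 ≤ Real.exp (z.re + δ * ‖z‖) := Real.one_le_exp (by positivity)
    have hKC : K ≤ (K + √B + √(B / (κ * δ))) * Real.exp (z.re + δ * ‖z‖) := by
      refine le_trans ?_ (le_mul_of_one_le_right (by positivity) h1e)
      linarith [Real.sqrt_nonneg B, Real.sqrt_nonneg (B / (κ * δ))]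
    have hmem : z ∈ Metric.closedBall (0 : ℂ) R := by simpa using hzR
    exact ⟨(hK₀ z hmem).trans ((le_max_left _ _).trans hKC),
      (hK₁ z hmem).trans ((le_max_right _ _).trans hKC)⟩
  have hz0 : 0 < ‖z‖ := hR.trans_le hRz
  set ω := z / ‖z‖ with hωdef
  have hz0' : (‖z‖ : ℂ) ≠ 0 := by exact_mod_cast hz0.ne'
  have hω : ‖ω‖ = 1 := by simp [hωdef, hz0.ne']
  have hωκ : κ ≤ ω.re := by
    rw [hωdef, Complex.div_ofReal_re, le_div_iff₀ hz0]; exact hz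
  have hzω : (‖z‖ : ℂ) * ω = z := mul_div_cancel₀ _ hz0'
  have hanti := kummer_energy_antitone hw hw₁ hode hκ hδ hR h1 h2 hω hωκ
    (mem_Ici.2 le_rfl) (mem_Ici.2 hRz) hRz
  simp only [hzω] at hanti
  have hmem : (R : ℂ) * ω ∈ Metric.closedBall (0 : ℂ) R := by simp [hω, abs_of_pos hR]
  have hER : ‖exp (-((R : ℂ) * ω))‖ ≤ 1 := by
    rw [Complex.norm_exp, Real.exp_le_one_iff]
    simpa using mul_nonneg hR.le (hκ.le.trans hωκ)
  have hbound {x : ℂ} (hx : ‖x‖ ≤ K) : ‖x * exp (-((R : ℂ) * ω))‖ ^ 2 ≤ K ^ 2 := by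
    rw [norm_mul]
    gcongr
    exact (mul_le_of_le_one_right (norm_nonneg _) hER).trans hx
  have hBR : ‖w₁ z * exp (-z)‖ ^ 2 + κ * δ * ‖w z * exp (-z)‖ ^ 2 ≤
      B * Real.exp (δ * ‖z‖) ^ 2 := by
    have e : Real.exp (δ * ‖z‖) ^ 2 * Real.exp (-(2 * δ * ‖z‖)) = 1 := by
      rw [← Real.exp_nat_mul, ← Real.exp_add, Real.exp_eq_one_iff]; push_cast; ring
    have h := hanti.trans (mul_le_of_le_one_left (by positivity)
      (Real.exp_le_one_iff.2 (by nlinarith [mul_pos hδ hR])))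
    have h' := h.trans (add_le_add (hbound ((hK₁ _ hmem).trans (le_max_right _ _)))
      (mul_le_mul_of_nonneg_left (hbound ((hK₀ _ hmem).trans (le_max_left _ _)))
        (by positivity)))
    have := mul_le_mul_of_nonneg_left h' (sq_nonneg (Real.exp (δ * ‖z‖)))
    rw [← mul_assoc, e, one_mul] at this
    linarith
  have finish {x : ℂ} {b : ℝ} (hb : 0 ≤ b) (hbC : √b ≤ K + √B + √(B / (κ * δ)))
      (hx : ‖x * exp (-z)‖ ^ 2 ≤ b * Real.exp (δ * ‖z‖) ^ 2) :
      ‖x‖ ≤ (K + √B + √(B / (κ * δ))) * Real.exp (z.re + δ * ‖z‖) := by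
    have h : ‖x * exp (-z)‖ ≤ √b * Real.exp (δ * ‖z‖) := by
      refine le_of_sq_le_sq ?_ (by positivity)
      rwa [mul_pow, Real.sq_sqrt hb]
    have e : ‖x‖ = ‖x * exp (-z)‖ * Real.exp z.re := by
      rw [← Complex.norm_exp, ← norm_mul, mul_assoc, ← Complex.exp_add]; simp
    rw [e, Real.exp_add, mul_comm (Real.exp z.re), ← mul_assoc]
    gcongr
    exact h.trans (by gcongr)
  constructor
  · refine finish (b := B / (κ * δ)) (by positivity) (by linarith [Real.sqrt_nonneg B]) ?_
    rw [div_mul_eq_mul_div, le_div_iff₀' (by positivity)]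
    linarith [sq_nonneg ‖w₁ z * exp (-z)‖]
  · refine finish hB (by linarith [Real.sqrt_nonneg (B / (κ * δ))]) ?_
    have : 0 ≤ κ * δ * ‖w z * exp (-z)‖ ^ 2 := by positivity
    linarith

/-- Terms of the Gauss series `₂F₁(a, b; c; 1/2)`. -/
noncomputable def gaussHalfTerm (a b c : ℂ) (n : ℕ) : ℂ :=
  kummerCoeff a c n * poch b n * (1 / 2) ^ n

lemma gaussHalfTerm_succ (b : ℂ) (hc : ∀ n : ℕ, c ≠ -(n : ℂ)) (n : ℕ) :
    gaussHalfTerm a b c (n + 1) =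
      (a + n) / (c + n) * ((b + n) / (1 + n)) * (1 / 2) * gaussHalfTerm a b c n := by
  simp only [gaussHalfTerm, kummerCoeff_succ' hc, poch_succ]
  ring

lemma summable_norm_gaussHalfTerm (b : ℂ) (hc : ∀ n : ℕ, c ≠ -(n : ℂ)) :
    Summable fun n => ‖gaussHalfTerm a b c n‖ := by
  refine summable_norm_of_tendsto_ratio (l := 1 / 2) (by norm_num) ?_ (gaussHalfTerm_succ b hc)
  simpa using (((tendsto_add_natCast_div a c).mul (tendsto_add_natCast_div b 1)).mul_const
    (1 / 2 : ℂ)).norm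

lemma poch_add_two (c : ℂ) (n : ℕ) :
    c * (c + 1) * poch (c + 2) n = poch c n * (c + n) * (c + n + 1) := by
  have h : poch c (n + 2) = c * ((c + 1) * poch (c + 2) n) := by
    rw [poch_succ_left, poch_succ_left]; ring_nf
  rw [mul_assoc, ← h, poch_succ, poch_succ]
  push_cast; ring

/-- Contiguous relation in the lower parameter at `z = 1/2`. -/
lemma tsum_gaussHalfTerm_add_two (hc : ∀ n : ℕ, c ≠ -(n : ℂ)) :
    c * (c + 1) * ∑' n, gaussHalfTerm a (1 - a) c n =
      (c + a) * (c + 1 - a) * ∑' n, gaussHalfTerm a (1 - a) (c + 2) n := by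
  have hc2 (n : ℕ) : c + 2 ≠ -(n : ℂ) := fun h => hc (n + 2) (by push_cast; linear_combination h)
  have S0 := (summable_norm_gaussHalfTerm (a := a) (1 - a) hc).of_norm
  have S2 := (summable_norm_gaussHalfTerm (a := a) (1 - a) hc2).of_norm
  have hc0 : c ≠ 0 := by simpa using hc 0
  have hc1 : c + 1 ≠ 0 := by simpa using add_natCast_ne_zero hc 1
  set G : ℕ → ℂ := fun n => -2 * c * (c + 1) * (n / (c + n)) * gaussHalfTerm a (1 - a) c n with hG
  have hstep (n : ℕ) : c * (c + 1) * gaussHalfTerm a (1 - a) c n -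
      (c + a) * (c + 1 - a) * gaussHalfTerm a (1 - a) (c + 2) n = G (n + 1) - G n := by
    have h1 := add_natCast_ne_zero hc n
    have h2 : c + n + 1 ≠ 0 := by
      have := add_natCast_ne_zero hc (n + 1); push_cast at this; rwa [← add_assoc] at this
    have h3 : (1 + n : ℂ) ≠ 0 := by rw [add_comm]; exact_mod_cast n.succ_ne_zero
    have h4 : gaussHalfTerm a (1 - a) (c + 2) n =
        c * (c + 1) / ((c + n) * (c + n + 1)) * gaussHalfTerm a (1 - a) c n := by
      have h5 := poch_ne_zero hc n
      have h6 := poch_ne_zero hc2 n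
      have h7 : (n.factorial : ℂ) ≠ 0 := by exact_mod_cast n.factorial_ne_zero
      have h8 := poch_add_two c n
      simp only [gaussHalfTerm, kummerCoeff]
      field_simp
      linear_combination -(poch a n * poch (1 - a) n) * h8
    simp only [hG, gaussHalfTerm_succ _ hc, h4]
    push_cast
    rw [← add_assoc]
    have h3' : (n + 1 : ℂ) ≠ 0 := by rwa [add_comm]
    field_simp
    ring
  have hG0 : Tendsto G atTop (𝓝 0) := by
    have := ((tendsto_add_natCast_div 0 c).const_mul (-2 * c * (c + 1))).mul
      S0.tendsto_atTop_zero
    simpa [hG] using this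
  have H := ((S0.hasSum.mul_left (c * (c + 1))).sub
    (S2.hasSum.mul_left ((c + a) * (c + 1 - a)))).tendsto_sum_nat
  simp only [hstep, Finset.sum_range_sub] at H
  have hG00 : G 0 = 0 := by simp [hG]
  rw [hG00] at H
  have := tendsto_nhds_unique H (by simpa using hG0)
  exact sub_eq_zero.1 this

lemma factorial_le_norm_poch (h : 1 ≤ c.re) (n : ℕ) : (n.factorial : ℝ) ≤ ‖poch c n‖ := by
  induction n with
  | zero => simp
  | succ n ih =>
    rw [poch_succ, norm_mul, Nat.factorial_succ, Nat.cast_mul, mul_comm]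
    gcongr
    refine le_trans ?_ (Complex.re_le_norm _)
    simp; linarith

lemma tendsto_tsum_gaussHalfTerm (a b c : ℂ) :
    Tendsto (fun N : ℕ => ∑' n, gaussHalfTerm a b (c + 2 * N) n) atTop (𝓝 1) := by
  have h1 (n : ℕ) : (1 : ℂ) ≠ -(n : ℂ) := fun h => by
    have := congrArg Complex.re h
    simp at this; linarith [n.cast_nonneg (α := ℝ)]
  have hinf : Tendsto (fun N : ℕ => c + 2 * (N : ℂ)) atTop (Bornology.cobounded ℂ) :=
    (tendsto_const_add_cobounded c).comp
      ((Filter.tendsto_mul_left_cobounded two_ne_zero).comp tendsto_natCast_atTop_cobounded)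
  have h0 (n : ℕ) : Tendsto (fun N : ℕ => (poch (c + 2 * N) (n + 1))⁻¹) atTop (𝓝 0) := by
    induction n with
    | zero => simpa [poch_succ, Function.comp_def] using tendsto_inv₀_cobounded.comp hinf
    | succ n ih =>
      have := ih.mul (tendsto_inv₀_cobounded.comp
        ((tendsto_add_const_cobounded ((n + 1 : ℕ) : ℂ)).comp hinf))
      simpa [poch_succ _ (n + 1), mul_inv_rev, mul_comm] using this
  have hlim (n : ℕ) : Tendsto (fun N : ℕ => gaussHalfTerm a b (c + 2 * N) n) atTop
      (𝓝 (if n = 0 then 1 else 0)) := by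
    cases n with
    | zero => simp [gaussHalfTerm, kummerCoeff]
    | succ n =>
      have := (h0 n).const_mul
        (poch a (n + 1) * ((n + 1).factorial : ℂ)⁻¹ * poch b (n + 1) * (1 / 2) ^ (n + 1))
      rw [mul_zero] at this
      simp only [Nat.succ_ne_zero, if_false]
      refine this.congr fun N => ?_
      simp only [gaussHalfTerm, kummerCoeff, div_eq_mul_inv, mul_inv]
      ring
  have := tendsto_tsum_of_dominated_convergence
    (summable_norm_gaussHalfTerm (a := a) b h1) hlim ?_
  · simpa using this
  · obtain ⟨N₀, hN₀⟩ := exists_nat_ge (1 - c.re)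
    filter_upwards [eventually_ge_atTop N₀] with N hN n
    have hN' : (N₀ : ℝ) ≤ N := by exact_mod_cast hN
    have hre : 1 ≤ (c + 2 * (N : ℂ)).re := by
      simp; linarith [N.cast_nonneg (α := ℝ)]
    have hf : ‖poch 1 n‖ = n.factorial := by simp [poch]
    have hpos : (0 : ℝ) < n.factorial := by exact_mod_cast n.factorial_pos
    simp only [gaussHalfTerm, kummerCoeff, norm_mul, norm_div, hf, Complex.norm_natCast]
    gcongr
    exact factorial_le_norm_poch hre n

lemma tendsto_inv_GammaSeq (s : ℂ) :
    Tendsto (fun n => (GammaSeq s n)⁻¹) atTop (𝓝 (Gamma s)⁻¹) := by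
  by_cases h : Gamma s = 0
  · obtain ⟨m, hm⟩ := (Complex.Gamma_eq_zero_iff s).1 h
    rw [h, inv_zero]
    refine tendsto_const_nhds.congr' ?_
    filter_upwards [eventually_ge_atTop m] with n hn
    have : ∏ j ∈ Finset.range (n + 1), (s + j) = 0 :=
      Finset.prod_eq_zero (Finset.mem_range.2 (Nat.lt_succ_of_le hn)) (by rw [hm]; simp)
    simp [GammaSeq, this]
  · exact (GammaSeq_tendsto_Gamma s).inv₀ h

lemma tsum_gaussHalfTerm_eq_prod (hc : ∀ n : ℕ, c ≠ -(n : ℂ)) (N : ℕ) :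
    ∑' n, gaussHalfTerm a (1 - a) c n =
      (∏ j ∈ Finset.range N, (((a + c) / 2 + j) * ((c - a + 1) / 2 + j) /
        ((c / 2 + j) * ((c + 1) / 2 + j)))) * ∑' n, gaussHalfTerm a (1 - a) (c + 2 * N) n := by
  induction N with
  | zero => simp
  | succ N ih =>
    have hcN (n : ℕ) : c + 2 * N ≠ -(n : ℂ) := fun h => hc (n + 2 * N) (by
      push_cast; linear_combination h)
    have h0 : c + 2 * N ≠ 0 := by simpa using hcN 0
    have h1 : c + 2 * N + 1 ≠ 0 := by simpa using add_natCast_ne_zero hcN 1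
    have h2 : c + 1 + 2 * N ≠ 0 := by convert h1 using 1; ring
    have h := tsum_gaussHalfTerm_add_two (a := a) hcN
    have e : c + 2 * ((N + 1 : ℕ) : ℂ) = c + 2 * N + 2 := by push_cast; ring
    rw [ih, Finset.prod_range_succ, e, mul_assoc]
    congr 1
    have e2 : ((a + c) / 2 + N) * ((c - a + 1) / 2 + N) / ((c / 2 + N) * ((c + 1) / 2 + N)) =
        (c + 2 * N + a) * (c + 2 * N + 1 - a) / ((c + 2 * N) * (c + 2 * N + 1)) := by
      rw [div_eq_div_iff (by
        refine mul_ne_zero ?_ ?_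
        · contrapose! h0; linear_combination 2 * h0
        · contrapose! h1; linear_combination 2 * h1) (mul_ne_zero h0 h1)]
      ring
    rw [e2, div_mul_eq_mul_div, eq_div_iff (mul_ne_zero h0 h1)]
    linear_combination h

/-- Bailey's summation theorem. -/
theorem tsum_gaussHalfTerm (hc : ∀ n : ℕ, c ≠ -(n : ℂ)) :
    ∑' n, gaussHalfTerm a (1 - a) c n =
      Gamma (c / 2) * Gamma ((c + 1) / 2) / (Gamma ((a + c) / 2) * Gamma ((c - a + 1) / 2)) := by
  have hprod (N : ℕ) (hN : N ≠ 0) : ∏ j ∈ Finset.range (N + 1),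
      (((a + c) / 2 + j) * ((c - a + 1) / 2 + j) / ((c / 2 + j) * ((c + 1) / 2 + j))) =
      GammaSeq (c / 2) N * GammaSeq ((c + 1) / 2) N *
        ((GammaSeq ((a + c) / 2) N)⁻¹ * (GammaSeq ((c - a + 1) / 2) N)⁻¹) := by
    have hN0 : (N : ℂ) ≠ 0 := by exact_mod_cast hN
    have hcp (x : ℂ) : (N : ℂ) ^ x ≠ 0 := by simp [Complex.cpow_eq_zero_iff, hN0]
    have hf : (N.factorial : ℂ) ≠ 0 := by exact_mod_cast N.factorial_ne_zero
    have hp : (N : ℂ) ^ (c / 2) * (N : ℂ) ^ ((c + 1) / 2) =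
        (N : ℂ) ^ ((a + c) / 2) * (N : ℂ) ^ ((c - a + 1) / 2) := by
      rw [← Complex.cpow_add _ _ hN0, ← Complex.cpow_add _ _ hN0]; ring_nf
    have e (p q r s A B C D f : ℂ) (hf : f ≠ 0) (hr : r ≠ 0) (hs : s ≠ 0) (h : p * q = r * s) :
        C * D / (A * B) = p * f / A * (q * f / B) * ((r * f / C)⁻¹ * (s * f / D)⁻¹) := by
      have : p * f / A * (q * f / B) * ((r * f / C)⁻¹ * (s * f / D)⁻¹) =
          (p * q) * (r * s)⁻¹ * (f * f⁻¹) ^ 2 * (C * D / (A * B)) := by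
        simp only [div_eq_mul_inv, mul_inv, inv_inv]; ring
      rw [this, h, mul_inv_cancel₀ (mul_ne_zero hr hs), mul_inv_cancel₀ hf]; ring
    rw [Finset.prod_div_distrib, Finset.prod_mul_distrib, Finset.prod_mul_distrib]
    exact e _ _ _ _ _ _ _ _ _ hf (hcp _) (hcp _) hp
  have hlim := ((GammaSeq_tendsto_Gamma (c / 2)).mul (GammaSeq_tendsto_Gamma ((c + 1) / 2))).mul
    ((tendsto_inv_GammaSeq ((a + c) / 2)).mul (tendsto_inv_GammaSeq ((c - a + 1) / 2)))
  have h1 := (tendsto_tsum_gaussHalfTerm a (1 - a) c).comp (tendsto_add_atTop_nat 1)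
  have h2 := hlim.mul h1
  rw [mul_one, ← mul_inv, ← div_eq_mul_inv] at h2
  refine tendsto_nhds_unique (tendsto_const_nhds.congr' ?_) h2
  filter_upwards [eventually_ne_atTop 0] with N hN
  rw [← hprod N hN]
  exact tsum_gaussHalfTerm_eq_prod hc (N + 1)

lemma Gamma_add_natCast_eq_poch {b : ℂ} (hb : 0 < b.re) (n : ℕ) :
    Gamma (b + n) = poch b n * Gamma b := by
  induction n with
  | zero => simp
  | succ n ih =>
    have : b + n ≠ 0 := fun h => by
      have := congrArg Complex.re h
      simp at this; linarith [n.cast_nonneg (α := ℝ)]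
    rw [poch_succ, Nat.cast_succ, ← add_assoc, Gamma_add_one _ this, ih]; ring

lemma integrableOn_rpow_mul_exp_neg_mul {x β : ℝ} (hx : -1 < x) (hβ : 0 < β) :
    IntegrableOn (fun t : ℝ => t ^ x * Real.exp (-(β * t))) (Ioi 0) := by
  simpa using integrableOn_rpow_mul_exp_neg_mul_rpow hx one_pos hβ

lemma continuousOn_ofReal_cpow (b : ℂ) : ContinuousOn (fun t : ℝ => (t : ℂ) ^ b) (Ioi 0) :=
  fun t ht => (continuousAt_ofReal_cpow_const t b (Or.inr (ne_of_gt ht))).continuousWithinAt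

/-- The Laplace integral at a positive real parameter, by termwise integration. -/
lemma integral_hyp_ofReal (ha : 0 < (1 - a).re) (hc : ∀ n : ℕ, c ≠ -(n : ℂ)) {r : ℝ}
    (hr : 0 < r) :
    ∫ t in Ioi (0 : ℝ), exp (-(r * t)) * (t : ℂ) ^ (-a) * hyp [a] [c] (r * t / 2) =
      (r : ℂ) ^ (a - 1) * Gamma (1 - a) * ∑' n, gaussHalfTerm a (1 - a) c n := by
  have hr0 : (r : ℂ) ≠ 0 := by exact_mod_cast hr.ne'
  set b : ℝ := (1 - a).re with hb
  set F : ℕ → ℝ → ℂ := fun n t =>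
    kummerCoeff a c n * (r / 2) ^ n * ((t : ℂ) ^ (1 - a + n - 1) * exp (-(r * t))) with hF
  have hcpow {t : ℝ} (ht : 0 < t) (n : ℕ) :
      (t : ℂ) ^ (1 - a + n - 1) = (t : ℂ) ^ (-a) * (t : ℂ) ^ n := by
    rw [← Complex.cpow_natCast, ← Complex.cpow_add _ _ (by exact_mod_cast ht.ne')]
    ring_nf
  have hre (n : ℕ) : 0 < (1 - a + n).re := by
    rw [Complex.add_re, Complex.natCast_re]; positivity
  have hnorm (n : ℕ) {t : ℝ} (ht : t ∈ Ioi (0 : ℝ)) : ‖F n t‖ =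
      ‖kummerCoeff a c n * (r / 2) ^ n‖ * (t ^ (b + n - 1) * Real.exp (-(r * t))) := by
    simp only [hF, norm_mul, Complex.norm_exp, Complex.norm_cpow_eq_rpow_re_of_pos ht]
    simp [hb]
  have hmeas (n : ℕ) : AEStronglyMeasurable (F n) (volume.restrict (Ioi 0)) := by
    refine ContinuousOn.aestronglyMeasurable ?_ measurableSet_Ioi
    exact ((continuousOn_ofReal_cpow _).mul (by fun_prop)).const_mul _
  have hint (n : ℕ) : IntegrableOn (F n) (Ioi 0) := by
    refine Integrable.mono' ((integrableOn_rpow_mul_exp_neg_mul (x := b + n - 1) (by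
      linarith [n.cast_nonneg (α := ℝ)]) hr).const_mul _) (hmeas n)
      ((ae_restrict_iff' measurableSet_Ioi).2 (ae_of_all _ fun t ht => (hnorm n ht).le))
  have hnormint (n : ℕ) : ∫ t in Ioi (0 : ℝ), ‖F n t‖ =
      ‖gaussHalfTerm a b c n‖ * ((1 / r) ^ b * Real.Gamma b) := by
    have hbn : 0 < b + n := by positivity
    rw [setIntegral_congr_fun measurableSet_Ioi fun t ht => hnorm n ht, integral_const_mul,
      Real.integral_rpow_mul_exp_neg_mul_Ioi hbn hr, Real.rpow_add (by positivity),
      Real.rpow_natCast]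
    have hG : Real.Gamma (b + n) = ‖poch b n‖ * Real.Gamma b := by
      have := congrArg norm (Gamma_add_natCast_eq_poch (b := (b : ℂ)) (by simpa using ha) n)
      rw [norm_mul, ← Complex.ofReal_natCast, ← Complex.ofReal_add, Complex.Gamma_ofReal,
        Complex.Gamma_ofReal, Complex.norm_real, Complex.norm_real,
        Real.norm_of_nonneg (Real.Gamma_pos_of_pos hbn).le,
        Real.norm_of_nonneg (Real.Gamma_pos_of_pos ha).le] at this
      exact this
    rw [hG]
    simp only [gaussHalfTerm, norm_mul, norm_pow, norm_div, Complex.norm_real, norm_one,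
      Real.norm_of_nonneg hr.le, Complex.norm_ofNat, div_pow, one_pow]
    field_simp
  have hval (n : ℕ) : ∫ t in Ioi (0 : ℝ), F n t =
      (r : ℂ) ^ (a - 1) * Gamma (1 - a) * gaussHalfTerm a (1 - a) c n := by
    have h1r : (1 / r : ℂ) ≠ 0 := one_div_ne_zero hr0
    have e : (1 / r : ℂ) ^ (1 - a) = (r : ℂ) ^ (a - 1) := by
      rw [one_div, Complex.inv_cpow _ _ (by
        rw [Complex.arg_ofReal_of_nonneg hr.le]; exact Real.pi_pos.ne), ← Complex.cpow_neg,
        neg_sub]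
    simp only [hF]
    rw [integral_const_mul, Complex.integral_cpow_mul_exp_neg_mul_Ioi (hre n) hr,
      Gamma_add_natCast_eq_poch ha, Complex.cpow_add _ _ h1r, Complex.cpow_natCast, e,
      gaussHalfTerm]
    have : (r / 2 : ℂ) ^ n * (1 / r) ^ n = (1 / 2) ^ n := by
      rw [← mul_pow]; congr 1; field_simp
    linear_combination kummerCoeff a c n * r ^ (a - 1) * poch (1 - a) n * Gamma (1 - a) * this
  have hsum := hasSum_integral_of_summable_integral_norm hint (by
    simp only [hnormint]
    exact (summable_norm_gaussHalfTerm (b : ℂ) hc).mul_right _)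
  have hlhs : ∫ t in Ioi (0 : ℝ), ∑' n, F n t =
      ∫ t in Ioi (0 : ℝ), exp (-(r * t)) * (t : ℂ) ^ (-a) * hyp [a] [c] (r * t / 2) := by
    refine setIntegral_congr_fun measurableSet_Ioi fun t ht => ?_
    simp only [hyp_one_one, ← tsum_mul_left]
    refine tsum_congr fun n => ?_
    simp only [hF]
    rw [hcpow ht]
    ring
  rw [← hlhs, ← hsum.tsum_eq, ← tsum_mul_left]
  exact tsum_congr hval

/-- The Laplace integral is holomorphic on the right half plane. -/
lemma differentiableOn_integral_hyp (ha : 0 < (1 - a).re) (hc : ∀ n : ℕ, c ≠ -(n : ℂ)) :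
    DifferentiableOn ℂ (fun s : ℂ => ∫ t in Ioi (0 : ℝ),
      exp (-(s * t)) * (t : ℂ) ^ (-a) * hyp [a] [c] (s * t / 2)) {s | 0 < s.re} := by
  intro s₀ hs₀
  replace hs₀ : 0 < s₀.re := hs₀
  set σ : ℝ := s₀.re / 2 with hσ
  have hσ0 : 0 < σ := half_pos hs₀
  have hs₀n : 0 < ‖s₀‖ := hs₀.trans_le (Complex.re_le_norm _)
  set κ : ℝ := σ / (2 * ‖s₀‖) with hκ
  have hκ0 : 0 < κ := by positivity
  set w₁ : ℂ → ℂ := fun z => a / c * hyp [a + 1] [c + 1] z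
  have hw (z : ℂ) : HasDerivAt (hyp [a] [c]) (w₁ z) z := hasDerivAt_hyp hc z
  have hw₁ (z : ℂ) : HasDerivAt w₁ (a / c * ((a + 1) / (c + 1) * hyp [a + 2] [c + 2] z)) z := by
    have := (hasDerivAt_hyp (a := a + 1) (add_one_ne_neg_natCast hc) z).const_mul (a / c)
    rwa [add_assoc a, add_assoc c, one_add_one_eq_two] at this
  obtain ⟨C, hC⟩ := exists_kummer_bound hw hw₁ (kummer_ode hc) hκ0 (half_pos hκ0)
  set β : ℝ := κ * σ / 4 with hβ
  have hβ0 : 0 < β := by positivity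
  have hball {s : ℂ} (hs : s ∈ Metric.ball s₀ σ) : σ ≤ s.re ∧ κ * ‖s‖ ≤ s.re := by
    rw [mem_ball_iff_norm] at hs
    have h1 : (s₀ - s).re ≤ σ := (Complex.re_le_norm _).trans (by rw [norm_sub_rev]; exact hs.le)
    have h2 : σ ≤ s.re := by rw [Complex.sub_re] at h1; linarith
    have h3 : ‖s‖ ≤ 2 * ‖s₀‖ := by
      have := norm_le_norm_add_norm_sub' s s₀
      linarith [Complex.re_le_norm s₀]
    refine ⟨h2, le_trans ?_ h2⟩
    calc κ * ‖s‖ ≤ κ * (2 * ‖s₀‖) := by gcongr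
      _ = σ := div_mul_cancel₀ _ (by positivity)
  have hdecay {s : ℂ} (hs : s ∈ Metric.ball s₀ σ) {t : ℝ} (ht : 0 < t) {x : ℂ}
      (hx : ‖x‖ ≤ C * Real.exp ((s * t / 2).re + κ / 2 * ‖s * t / 2‖)) :
      ‖exp (-(s * t)) * x‖ ≤ C * Real.exp (-(β * t)) := by
    obtain ⟨h1, h2⟩ := hball hs
    have hC0 : 0 ≤ C := nonneg_of_mul_nonneg_left ((norm_nonneg _).trans hx) (Real.exp_pos _)
    have e1 : (s * t / 2).re = s.re * t / 2 := by
      rw [show (s * t / 2 : ℂ) = s * ((t / 2 : ℝ) : ℂ) by push_cast; ring, Complex.re_mul_ofReal]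
      ring
    have e2 : ‖s * t / 2‖ = ‖s‖ * t / 2 := by simp [abs_of_pos ht]
    rw [norm_mul, Complex.norm_exp, Complex.neg_re, Complex.re_mul_ofReal]
    calc Real.exp (-(s.re * t)) * ‖x‖
        ≤ Real.exp (-(s.re * t)) * (C * Real.exp ((s * t / 2).re + κ / 2 * ‖s * t / 2‖)) := by
          gcongr
      _ = C * Real.exp (-(s.re * t) + ((s * t / 2).re + κ / 2 * ‖s * t / 2‖)) := by
          rw [Real.exp_add (-(s.re * t)), mul_left_comm]
      _ ≤ C * Real.exp (-(β * t)) := by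
          gcongr
          rw [e1, e2]
          have h3 : κ ≤ 1 := by
            rw [hκ, div_le_one (by positivity)]
            linarith [Complex.re_le_norm s₀]
          have h4 : κ * σ ≤ s.re := (mul_le_of_le_one_left hσ0.le h3).trans h1
          nlinarith [mul_le_mul_of_nonneg_right h2 ht.le, mul_le_mul_of_nonneg_right h4 ht.le]
  have hsector {s : ℂ} (hs : s ∈ Metric.ball s₀ σ) {t : ℝ} (ht : 0 < t) :
      κ * ‖s * t / 2‖ ≤ (s * t / 2).re := by
    have e1 : (s * t / 2 : ℂ) = s * ((t / 2 : ℝ) : ℂ) := by push_cast; ring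
    rw [e1, Complex.re_mul_ofReal, norm_mul, Complex.norm_real,
      Real.norm_of_nonneg (by positivity), ← mul_assoc]
    have := (hball hs).2
    gcongr
  have hcw : Continuous (hyp [a] [c]) := continuous_iff_continuousAt.2 fun z => (hw z).continuousAt
  have hcw₁ : Continuous w₁ := continuous_iff_continuousAt.2 fun z => (hw₁ z).continuousAt
  have hmeas (s : ℂ) : AEStronglyMeasurable (fun t : ℝ =>
      exp (-(s * t)) * (t : ℂ) ^ (-a) * hyp [a] [c] (s * t / 2)) (volume.restrict (Ioi 0)) := by
    refine ContinuousOn.aestronglyMeasurable ?_ measurableSet_Ioi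
    exact (ContinuousOn.mul (by fun_prop) (continuousOn_ofReal_cpow _)).mul (by fun_prop)
  have hcpow {t : ℝ} (ht : 0 < t) : ‖(t : ℂ) ^ (-a)‖ = t ^ (-a.re) := by
    rw [Complex.norm_cpow_eq_rpow_re_of_pos ht, Complex.neg_re]
  have hare : a.re < 1 := by simpa using ha
  have hs₀ball : s₀ ∈ Metric.ball s₀ σ := Metric.mem_ball_self hσ0
  have hint : IntegrableOn (fun t : ℝ =>
      exp (-(s₀ * t)) * (t : ℂ) ^ (-a) * hyp [a] [c] (s₀ * t / 2)) (Ioi 0) := by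
    refine Integrable.mono' ((integrableOn_rpow_mul_exp_neg_mul (x := -a.re) (by linarith)
      hβ0).const_mul C) (hmeas s₀)
      ((ae_restrict_iff' measurableSet_Ioi).2 (ae_of_all _ fun t ht => ?_))
    rw [mul_comm (exp _), mul_assoc, norm_mul, hcpow ht, mul_left_comm]
    exact mul_le_mul_of_nonneg_left (hdecay hs₀ball ht (hC _ (hsector hs₀ball ht)).1)
      (Real.rpow_nonneg (le_of_lt ht) _)
  refine DifferentiableAt.differentiableWithinAt (HasDerivAt.differentiableAt
    (hasDerivAt_integral_of_dominated_loc_of_deriv_le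
      (bound := fun t => 2 * C * (t ^ (1 - a.re) * Real.exp (-(β * t))))
      (F' := fun s t => (t : ℂ) ^ (-a) * t * (-(exp (-(s * t)) * hyp [a] [c] (s * t / 2)) +
        exp (-(s * t)) * w₁ (s * t / 2) / 2))
      (Metric.ball_mem_nhds s₀ hσ0) (Eventually.of_forall hmeas) hint ?_ ?_ ?_ ?_).2)
  · refine ContinuousOn.aestronglyMeasurable ?_ measurableSet_Ioi
    exact (ContinuousOn.mul (continuousOn_ofReal_cpow _) (by fun_prop)).mul (by fun_prop)
  · refine (ae_restrict_iff' measurableSet_Ioi).2 (ae_of_all _ fun t ht s hs => ?_)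
    have h0 := hdecay hs ht (hC _ (hsector hs ht)).1
    have h1 := hdecay hs ht (hC _ (hsector hs ht)).2
    have ht0 : (0 : ℝ) < t := ht
    rw [norm_mul, norm_mul, hcpow ht, Complex.norm_real, Real.norm_of_nonneg ht0.le,
      show 1 - a.re = -a.re + 1 by ring, Real.rpow_add_one ht0.ne']
    have h2 : ‖-(exp (-(s * t)) * hyp [a] [c] (s * t / 2)) + exp (-(s * t)) * w₁ (s * t / 2) / 2‖
        ≤ 2 * (C * Real.exp (-(β * t))) := by
      refine (norm_add_le _ _).trans ?_
      rw [norm_neg, norm_div, Complex.norm_ofNat]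
      linarith [norm_nonneg (exp (-(s * t)) * w₁ (s * t / 2))]
    have h3 : 0 ≤ t ^ (-a.re) * t := by positivity
    calc _ ≤ t ^ (-a.re) * t * (2 * (C * Real.exp (-(β * t)))) := by gcongr
      _ = _ := by ring
  · exact (integrableOn_rpow_mul_exp_neg_mul (by linarith) hβ0).const_mul _
  · refine ae_of_all _ fun t s _ => ?_
    have h1 : HasDerivAt (fun s : ℂ => s * t) t s := by
      simpa using (hasDerivAt_id s).mul_const (t : ℂ)
    have := (h1.neg.cexp.mul_const ((t : ℂ) ^ (-a))).mul ((hw (s * t / 2)).comp s (h1.div_const 2))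
    convert! this using 1
    simp only [Function.comp_apply, Pi.neg_apply]
    ring

end

theorem stmt4 (a c s : ℂ) (ha : 0 < (1 - a).re) (hs : 0 < s.re)
    (hc : (∀ n : ℕ, c ≠ -(n : ℂ))) :
    ∫ t in Ioi (0:ℝ), Complex.exp (-(s * t)) * (t : ℂ) ^ (-a) * hyp [a] [c] (s * t / 2)
      = s ^ (a - 1) * Complex.Gamma (1 - a) * Complex.Gamma (c / 2) * Complex.Gamma ((c + 1) / 2) /
          (Complex.Gamma ((a + c) / 2) * Complex.Gamma ((c - a + 1) / 2)) := by
  have hU : IsOpen {s : ℂ | 0 < s.re} := isOpen_lt continuous_const Complex.continuous_re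
  have hR : DifferentiableOn ℂ (fun s : ℂ =>
      s ^ (a - 1) * Gamma (1 - a) * ∑' n, gaussHalfTerm a (1 - a) c n) {s | 0 < s.re} := by
    refine DifferentiableOn.mul_const (DifferentiableOn.mul_const ?_ _) _
    exact fun s hs => (differentiableAt_id.cpow_const (Or.inl hs)).differentiableWithinAt
  have hfreq : ∃ᶠ z in 𝓝[≠] (1 : ℂ), (∫ t in Ioi (0 : ℝ),
      exp (-(z * t)) * (t : ℂ) ^ (-a) * hyp [a] [c] (z * t / 2)) =
        z ^ (a - 1) * Gamma (1 - a) * ∑' n, gaussHalfTerm a (1 - a) c n := by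
    have hlim : Tendsto (fun r : ℝ => (r : ℂ)) (𝓝[>] 1) (𝓝[≠] (1 : ℂ)) := by
      refine tendsto_nhdsWithin_iff.2 ⟨?_, ?_⟩
      · exact (Complex.continuous_ofReal.tendsto' 1 1 Complex.ofReal_one).mono_left
          nhdsWithin_le_nhds
      · filter_upwards [self_mem_nhdsWithin] with r hr
        simpa using ne_of_gt hr
    refine hlim.frequently (Eventually.frequently ?_)
    filter_upwards [self_mem_nhdsWithin] with r hr
    exact integral_hyp_ofReal ha hc (zero_lt_one.trans hr)
  have := ((differentiableOn_integral_hyp ha hc).analyticOnNhd hU)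
    |>.eqOn_of_preconnected_of_frequently_eq (hR.analyticOnNhd hU)
      (convex_halfSpace_re_gt 0).isPreconnected (z₀ := 1) (by simp) hfreq hs
  refine this.trans ?_
  simp only [tsum_gaussHalfTerm hc]
  ring
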